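/- There exists a fanatic agent if and only if there is no protocol F = (F_1,…,F_N) in which the truthful profile (s^t,…,s^t) is an equilibrium. -/

import Mathlib

open scoped Classical
noncomputable section

/-- A strategy of an agent: `(p, q)` with `p = P(mᵢ = 0 ∣ bᵢ = 0)`, `q = P(mᵢ = 0 ∣ bᵢ = 1)`. -/
abbrev Strategy : Type := (Set.Icc (0:ℝ) 1) × (Set.Icc (0:ℝ) 1)

/-- The truthful strategy `sᵗ = (1,0)`. -/
def sT : Strategy := (⟨1, by norm_num⟩, ⟨0, by norm_num⟩)

/-- A zero-information strategy: `p = q`. -/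
def ZeroInfo (s : Strategy) : Prop := (s.1 : ℝ) = (s.2 : ℝ)

/-- Vectors of `N+1` bits (bits of the center and the `N` agents; also used for
message vectors and for the center's replies).  Coordinate `0` is the center. -/
abbrev Bits (N : ℕ) : Type := Fin (N+1) → Bool

/-- A strategy profile of the `N` agents. -/
abbrev Profile (N : ℕ) : Type := Fin N → Strategy

/-- A protocol for a single agent: a map from strategy profiles and message vectors to
distributions over replies `f ∈ {0,1}^{N+1}`. -/
abbrev Protocol (N : ℕ) : Type := Profile N → Bits N → PMF (Bits N)

/-- `P(message = msg ∣ bit = bit)` under strategy `s` (where `false` plays the role of `0`). -/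
def strandP (s : Strategy) (bit msg : Bool) : ℝ :=
  if msg then 1 - (if bit then (s.2 : ℝ) else (s.1 : ℝ))
  else (if bit then (s.2 : ℝ) else (s.1 : ℝ))

/-- `P(messages = m ∣ bits = b)` under profile `s`; the center's message is her own bit. -/
def msgP {N : ℕ} (s : Profile N) (b m : Bits N) : ℝ :=
  (if m 0 = b 0 then (1:ℝ) else 0) * ∏ i : Fin N, strandP (s i) (b i.succ) (m i.succ)

/-- Joint probability of bits `b`, messages `m` and reply `f` (to the relevant agent),
under profile `s` and protocol `F`; bits are i.i.d. uniform. -/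
def jointP {N : ℕ} (s : Profile N) (F : Protocol N) (b m f : Bits N) : ℝ :=
  ((1:ℝ)/2)^(N+1) * msgP s b m * ((F s m) f).toReal

/-- `P(bᵢ = bi, mᵢ = mi, fᵢ = f, g(b) = val)` for agent `i` (coordinate `i.succ`). -/
def pObs {N : ℕ} (g : Bits N → Bool) (s : Profile N) (F : Protocol N) (i : Fin N)
    (bi mi : Bool) (f : Bits N) (val : Bool) : ℝ :=
  ∑ b : Bits N, ∑ m : Bits N,
    if b i.succ = bi ∧ m i.succ = mi ∧ g b = val then jointP s F b m f else 0

/-- `P(bᵢ = bi, mᵢ = mi, fᵢ = f)` for agent `i`. -/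
def pObsAll {N : ℕ} (s : Profile N) (F : Protocol N) (i : Fin N)
    (bi mi : Bool) (f : Bits N) : ℝ :=
  ∑ b : Bits N, ∑ m : Bits N,
    if b i.succ = bi ∧ m i.succ = mi then jointP s F b m f else 0

/-- `P(b_k = 1, bᵢ = bi, mᵢ = mi, fᵢ = f)` for agent `i`. -/
def pBit {N : ℕ} (s : Profile N) (F : Protocol N) (i : Fin N)
    (bi mi : Bool) (f : Bits N) (k : Fin (N+1)) : ℝ :=
  ∑ b : Bits N, ∑ m : Bits N,
    if b i.succ = bi ∧ m i.succ = mi ∧ b k = true then jointP s F b m f else 0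

/-- The posterior `v_k = P(b_k = 1 ∣ fᵢ, mᵢ, bᵢ)` of agent `i` at the realization
`(bi, mi, f)`. -/
def post {N : ℕ} (s : Profile N) (F : Protocol N) (i : Fin N)
    (bi mi : Bool) (f : Bits N) (k : Fin (N+1)) : ℝ :=
  pBit s F i bi mi f k / pObsAll s F i bi mi f

/-- Expected profit `V_i(s⃗; F_i)`: after observing `(bᵢ, mᵢ, fᵢ)` the agent guesses the
more likely value of `g(b)` (uniformly at random in case of a tie) and earns `c i` iff
the guess is correct. -/
def V {N : ℕ} (g : Bits N → Bool) (c : Fin N → ℝ) (s : Profile N) (F : Protocol N)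
    (i : Fin N) : ℝ :=
  c i * ∑ bi : Bool, ∑ mi : Bool, ∑ f : Bits N,
    (if pObs g s F i bi mi f true > pObs g s F i bi mi f false then pObs g s F i bi mi f true
     else if pObs g s F i bi mi f false > pObs g s F i bi mi f true then
       pObs g s F i bi mi f false
     else (pObs g s F i bi mi f false + pObs g s F i bi mi f true) / 2)

/-- Utility `U_i(s⃗; F_i) = V_i(s⃗; F_i) − priceᵢ(sᵢ)`. -/
def U {N : ℕ} (g : Bits N → Bool) (c : Fin N → ℝ) (price : Fin N → Strategy → ℝ)
    (s : Profile N) (F : Protocol N) (i : Fin N) : ℝ :=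
  V g c s F i - price i (s i)

/-- The all-truthful profile `(sᵗ, …, sᵗ)`. -/
def truthProfile (N : ℕ) : Profile N := fun _ => sT

/-- `s⃗` is an equilibrium of the protocol `F = (F_1,…,F_N)`. -/
def Equilibrium {N : ℕ} (g : Bits N → Bool) (c : Fin N → ℝ) (price : Fin N → Strategy → ℝ)
    (s : Profile N) (FF : Fin N → Protocol N) : Prop :=
  ∀ i : Fin N, ∀ s' : Strategy,
    U g c price s (FF i) i ≥ U g c price (Function.update s i s') (FF i) i

/-- The improvement `F_i⁺` of a protocol `F_i`: it agrees with `F_i` when `s_i` is a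
zero-information strategy, and otherwise returns the reply whose first coordinate is
`m₀ = b₀` and whose remaining coordinates are those of `F_i`'s reply. -/
def improve {N : ℕ} (i : Fin N) (F : Protocol N) : Protocol N := fun s m =>
  if ZeroInfo (s i) then F s m
  else PMF.map (fun f => Function.update f 0 (m 0)) (F s m)

/-- The center is helpless. -/
def Helpless (N : ℕ) (g : Bits N → Bool) (c : Fin N → ℝ)
    (price : Fin N → Strategy → ℝ) : Prop :=
  ∀ i : Fin N, ∀ F : Protocol N, ∀ si : Strategy, ¬ ZeroInfo si →
    ∀ sr : Profile N, (∀ j, ZeroInfo (sr j)) →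
      U g c price sr F i ≥ U g c price (Function.update sr i si) (improve i F) i

/-- Relative price `price_i^r(s_i) = price_i(s_i) / price_i(sᵗ)`. -/
def priceR {N : ℕ} (price : Fin N → Strategy → ℝ) (i : Fin N) (s : Strategy) : ℝ :=
  price i s / price i sT

/-- The competitive protocol (the component `F_i^c` for agent `i`). -/
def Fc {N : ℕ} (price : Fin N → Strategy → ℝ) (i : Fin N) : Protocol N := fun s m =>
  if ∀ j, s j = sT then PMF.pure m
  else if ∀ j, j ≠ i → priceR price j (s j) < priceR price i (s i) then PMF.pure m
  else PMF.uniformOfFintype (Bits N)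

/-- The protocol that always replies the full message vector `m = (b₀, m₁, …, m_N)`. -/
def Fmax (N : ℕ) : Protocol N := fun _ m => PMF.pure m

/-- The protocol that always replies `N+1` independent uniform random bits. -/
def Fmin (N : ℕ) : Protocol N := fun _ _ => PMF.uniformOfFintype (Bits N)

/-- Agent `i` is fanatic. -/
def Fanatic {N : ℕ} (g : Bits N → Bool) (c : Fin N → ℝ) (price : Fin N → Strategy → ℝ)
    (i : Fin N) : Prop :=
  ∀ s : Profile N,
    price i sT > V g c (truthProfile N) (Fmax N) i - V g c s (Fmin N) i

/-- The fair competitive protocol (the component `F_i^{fc}` for agent `i`). -/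
def Ffc {N : ℕ} (price : Fin N → Strategy → ℝ) (i : Fin N) : Protocol N := fun s m =>
  if s i = sT then PMF.pure m
  else if (∃ j, j ≠ i ∧ s j ≠ sT) ∧
      (∀ j, j ≠ i → s j ≠ sT → priceR price j (s j) < priceR price i (s i)) then PMF.pure m
  else PMF.uniformOfFintype (Bits N)

/-- The joint probability `P(bᵢ = bi, g(b) = val)`, before any communication. -/
def prior {N : ℕ} (g : Bits N → Bool) (i : Fin N) (bi val : Bool) : ℝ :=
  ∑ b : Bits N, if b i.succ = bi ∧ g b = val then ((1:ℝ)/2)^(N+1) else 0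

theorem strandP_nonneg (s : Strategy) (x y : Bool) : 0 ≤ strandP s x y := by
  have h1 := s.1.2
  have h2 := s.2.2
  simp only [Set.mem_Icc] at h1 h2
  unfold strandP
  split_ifs <;> linarith

theorem sum_strandP (s : Strategy) (x : Bool) : ∑ y : Bool, strandP s x y = 1 := by
  simp [strandP]

theorem msgP_nonneg {N : ℕ} (s : Profile N) (b m : Bits N) : 0 ≤ msgP s b m :=
  mul_nonneg (by split_ifs <;> norm_num) (Finset.prod_nonneg fun _ _ => strandP_nonneg _ _ _)

theorem sum_msgP_of_apply_eq {N : ℕ} (s : Profile N) (b : Bits N) (i : Fin N) (mi : Bool) :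
    (∑ m : Bits N, if m i.succ = mi then msgP s b m else 0) = strandP (s i) (b i.succ) mi := by
  let h : Fin (N+1) → Bool → ℝ := Fin.cons (fun x => if x = b 0 then 1 else 0)
    (fun j x => strandP (s j) (b j.succ) x)
  let w : Fin (N+1) → Bool → ℝ := fun k x => if k = i.succ then (if x = mi then 1 else 0) else 1
  have key (m : Bits N) : (if m i.succ = mi then msgP s b m else 0)
      = ∏ k, h k (m k) * w k (m k) := by
    rw [Finset.prod_mul_distrib, Fin.prod_univ_succ]
    have hw : ∏ k, w k (m k) = if m i.succ = mi then 1 else 0 := by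
      rw [Finset.prod_eq_single i.succ] <;> simp +contextual [w]
    rw [hw]
    simp [h, msgP]
  simp_rw [key]
  rw [← Fintype.prod_sum (fun k x => h k x * w k x), Finset.prod_eq_single i.succ]
  · simp [h, w]
  · intro k _ hk
    cases k using Fin.cases with
    | zero => simp [h, w, hk]
    | succ j =>
      simp only [w, hk, if_false, mul_one]
      exact sum_strandP (s j) (b j.succ)
  · simp

theorem sum_msgP {N : ℕ} (s : Profile N) (b : Bits N) (i : Fin N) :
    ∑ m : Bits N, msgP s b m = 1 := by
  rw [← sum_strandP (s i) (b i.succ)]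
  simp_rw [← sum_msgP_of_apply_eq]
  rw [Finset.sum_comm]
  simp

theorem sum_toReal_pmf {α : Type*} [Fintype α] (p : PMF α) : ∑ a, (p a).toReal = 1 := by
  rw [← ENNReal.toReal_sum fun a _ => p.apply_ne_top a, ← tsum_fintype (L := .unconditional α), p.tsum_coe]
  rfl

theorem pObs_nonneg {N : ℕ} (g : Bits N → Bool) (s : Profile N) (F : Protocol N) (i : Fin N)
    (bi mi : Bool) (f : Bits N) (val : Bool) : 0 ≤ pObs g s F i bi mi f val := by
  refine Finset.sum_nonneg fun b _ => Finset.sum_nonneg fun m _ => ?_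
  split_ifs
  · exact mul_nonneg (mul_nonneg (by positivity) (msgP_nonneg s b m)) ENNReal.toReal_nonneg
  · exact le_rfl

theorem sum_pObs {N : ℕ} (g : Bits N → Bool) (s : Profile N) (F : Protocol N) (i : Fin N)
    (bi val : Bool) : ∑ mi : Bool, ∑ f : Bits N, pObs g s F i bi mi f val = prior g i bi val := by
  have hf (mi : Bool) : ∑ f : Bits N, pObs g s F i bi mi f val = ∑ b : Bits N, ∑ m : Bits N,
      if b i.succ = bi ∧ m i.succ = mi ∧ g b = val then ((1:ℝ)/2)^(N+1) * msgP s b m else 0 := by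
    unfold pObs
    rw [Finset.sum_comm]
    refine Finset.sum_congr rfl fun b _ => ?_
    rw [Finset.sum_comm]
    refine Finset.sum_congr rfl fun m _ => ?_
    split_ifs
    · simp only [jointP, ← Finset.mul_sum, sum_toReal_pmf, mul_one]
    · exact Finset.sum_const_zero
  simp_rw [hf]
  unfold prior
  rw [Finset.sum_comm]
  refine Finset.sum_congr rfl fun b _ => ?_
  by_cases h : b i.succ = bi ∧ g b = val
  · rw [if_pos h, Finset.sum_comm]
    simp only [h, true_and, and_true, Finset.sum_ite_eq, Finset.mem_univ, if_true,
      ← Finset.mul_sum, sum_msgP s b i, mul_one]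
  · rw [if_neg h]
    exact Finset.sum_eq_zero fun mi _ => Finset.sum_eq_zero fun m _ =>
      if_neg fun h' => h ⟨h'.1, h'.2.2⟩

theorem pObs_Fmin {N : ℕ} (g : Bits N → Bool) (s : Profile N) (i : Fin N)
    (bi mi : Bool) (f : Bits N) (val : Bool) :
    pObs g s (Fmin N) i bi mi f val =
      strandP (s i) bi mi * (PMF.uniformOfFintype (Bits N) f).toReal * prior g i bi val := by
  unfold pObs prior
  rw [Finset.mul_sum]
  refine Finset.sum_congr rfl fun b _ => ?_
  by_cases h : b i.succ = bi ∧ g b = val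
  · rw [if_pos h, ← h.1, ← sum_msgP_of_apply_eq, Finset.sum_mul, Finset.sum_mul]
    refine Finset.sum_congr rfl fun m _ => ?_
    by_cases hm : m i.succ = mi
    · simp only [h.2, hm, and_self, if_true, jointP, Fmin]
      ring
    · simp [hm]
  · rw [if_neg h, mul_zero]
    exact Finset.sum_eq_zero fun m _ => if_neg fun h' => h ⟨h'.1, h'.2.2⟩

theorem V_eq_sum_max {N : ℕ} (g : Bits N → Bool) (c : Fin N → ℝ) (s : Profile N)
    (F : Protocol N) (i : Fin N) :
    V g c s F i = c i * ∑ bi : Bool, ∑ mi : Bool, ∑ f : Bits N,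
      max (pObs g s F i bi mi f true) (pObs g s F i bi mi f false) := by
  unfold V
  congr 1
  refine Finset.sum_congr rfl fun bi _ => Finset.sum_congr rfl fun mi _ =>
    Finset.sum_congr rfl fun f _ => ?_
  split_ifs with h1 h2
  · exact (max_eq_left h1.le).symm
  · exact (max_eq_right h2.le).symm
  · have h := le_antisymm (not_lt.1 h1) (not_lt.1 h2)
    rw [h, max_self]
    ring

theorem V_Fmin {N : ℕ} (g : Bits N → Bool) (c : Fin N → ℝ) (s : Profile N) (i : Fin N) :
    V g c s (Fmin N) i = c i * ∑ bi : Bool, max (prior g i bi true) (prior g i bi false) := by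
  rw [V_eq_sum_max]
  congr 1
  refine Finset.sum_congr rfl fun bi _ => ?_
  simp_rw [pObs_Fmin, ← mul_max_of_nonneg _ _
    (mul_nonneg (strandP_nonneg _ _ _) ENNReal.toReal_nonneg), ← Finset.sum_mul,
    ← Finset.mul_sum, sum_toReal_pmf, mul_one, sum_strandP, one_mul]

theorem V_Fmin_le {N : ℕ} (g : Bits N → Bool) (c : Fin N → ℝ) (s s' : Profile N)
    (F : Protocol N) (i : Fin N) (hc : 0 ≤ c i) : V g c s (Fmin N) i ≤ V g c s' F i := by
  rw [V_Fmin, V_eq_sum_max]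
  refine mul_le_mul_of_nonneg_left (Finset.sum_le_sum fun bi _ => ?_) hc
  rw [← sum_pObs g s' F i bi true, ← sum_pObs g s' F i bi false]
  refine max_le ?_ ?_
  · exact Finset.sum_le_sum fun mi _ => Finset.sum_le_sum fun f _ => le_max_left _ _
  · exact Finset.sum_le_sum fun mi _ => Finset.sum_le_sum fun f _ => le_max_right _ _

theorem strandP_sT (x y : Bool) : strandP sT x y = if y = x then 1 else 0 := by
  cases x <;> cases y <;> simp [strandP, sT]

theorem msgP_truthProfile_of_ne {N : ℕ} {b m : Bits N} (h : m ≠ b) :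
    msgP (truthProfile N) b m = 0 := by
  obtain ⟨k, hk⟩ := Function.ne_iff.1 h
  unfold msgP
  cases k using Fin.cases with
  | zero => rw [if_neg hk, zero_mul]
  | succ j =>
    rw [Finset.prod_eq_zero (Finset.mem_univ j), mul_zero]
    simp [truthProfile, strandP_sT, hk]

theorem pObs_truthProfile_Fmax_of_ne {N : ℕ} (g : Bits N → Bool) (i : Fin N) (bi mi : Bool)
    {f : Bits N} {val : Bool} (h : g f ≠ val) :
    pObs g (truthProfile N) (Fmax N) i bi mi f val = 0 := by
  refine Finset.sum_eq_zero fun b _ => Finset.sum_eq_zero fun m _ => ?_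
  split_ifs with hb
  · unfold jointP
    by_cases hm : m = b
    · have hf : f ≠ m := by
        rintro rfl
        exact h (hm ▸ hb.2.2)
      simp [Fmax, PMF.pure_apply, hf]
    · rw [msgP_truthProfile_of_ne hm, mul_zero, zero_mul]
  · rfl

theorem V_le_V_truthProfile_Fmax {N : ℕ} (g : Bits N → Bool) (c : Fin N → ℝ) (s : Profile N)
    (F : Protocol N) (i : Fin N) (hc : 0 ≤ c i) :
    V g c s F i ≤ V g c (truthProfile N) (Fmax N) i := by
  rw [V_eq_sum_max, V_eq_sum_max]
  refine mul_le_mul_of_nonneg_left (Finset.sum_le_sum fun bi _ => ?_) hc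
  calc _ ≤ ∑ mi : Bool, ∑ f : Bits N,
        (pObs g s F i bi mi f true + pObs g s F i bi mi f false) :=
        Finset.sum_le_sum fun mi _ => Finset.sum_le_sum fun f _ =>
          max_le_add_of_nonneg (pObs_nonneg ..) (pObs_nonneg ..)
    _ = ∑ mi : Bool, ∑ f : Bits N, (pObs g (truthProfile N) (Fmax N) i bi mi f true
          + pObs g (truthProfile N) (Fmax N) i bi mi f false) := by
        simp_rw [Finset.sum_add_distrib, sum_pObs]
    _ ≤ _ := by
        refine Finset.sum_le_sum fun mi _ => Finset.sum_le_sum fun f _ => ?_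
        cases h : g f
        · simp [pObs_truthProfile_Fmax_of_ne g i bi mi (f := f) (val := true) (by simp [h])]
        · simp [pObs_truthProfile_Fmax_of_ne g i bi mi (f := f) (val := false) (by simp [h])]

/-- `V` depends on the protocol only through its values at the given profile. -/
theorem V_congr {N : ℕ} (g : Bits N → Bool) (c : Fin N → ℝ) {s : Profile N}
    {F F' : Protocol N} (i : Fin N) (h : F s = F' s) : V g c s F i = V g c s F' i := by
  have hp : pObs g s F i = pObs g s F' i := by
    unfold pObs jointP
    rw [h]
  unfold V
  rw [hp]

/-- a fanatic agent exists iff no protocol has a truthful equilibrium. -/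
theorem fanatic_iff_no_truthful_equilibrium (N : ℕ) (hN : 2 ≤ N) (g : Bits N → Bool) (c : Fin N → ℝ)
    (hc : ∀ i, 0 < c i)
    (price : Fin N → Strategy → ℝ)
    (hpriceCont : ∀ i, Continuous (price i))
    (hprice0 : ∀ i s, ZeroInfo s → price i s = 0)
    (hpricePos : ∀ i s, ¬ ZeroInfo s → 0 < price i s)
    (hpriceMax : ∀ i s, price i s ≤ price i sT) :
    (∃ i : Fin N, Fanatic g c price i) ↔
      ¬ ∃ FF : Fin N → Protocol N, Equilibrium g c price (truthProfile N) FF := by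
  have hnonneg (i : Fin N) (s : Strategy) : 0 ≤ price i s := by
    by_cases h : ZeroInfo s
    · exact (hprice0 i s h).ge
    · exact (hpricePos i s h).le
  constructor
  · rintro ⟨i, hi⟩ ⟨FF, hF⟩
    let z : Strategy := (⟨0, by norm_num⟩, ⟨0, by norm_num⟩)
    have h := hF i z
    have hz : price i z = 0 := hprice0 i z rfl
    have h1 := V_le_V_truthProfile_Fmax g c (truthProfile N) (FF i) i (hc i).le
    have h2 := V_Fmin_le g c (truthProfile N) (Function.update (truthProfile N) i z) (FF i) i
      (hc i).le
    have h3 := hi (truthProfile N)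
    simp only [U, Function.update_self, hz] at h
    have h4 : truthProfile N i = sT := rfl
    rw [h4] at h
    linarith
  · intro h
    by_contra! hno
    refine h ⟨fun i s m => if s i = sT then PMF.pure m else PMF.uniformOfFintype (Bits N),
      fun i s' => ?_⟩
    by_cases hs : s' = sT
    · subst hs
      rw [show Function.update (truthProfile N) i sT = truthProfile N from
        Function.update_eq_self i _]
    · obtain ⟨s, hi⟩ : ∃ s : Profile N,
          price i sT ≤ V g c (truthProfile N) (Fmax N) i - V g c s (Fmin N) i := by
        simpa [Fanatic] using hno i
      unfold U
      rw [V_congr g c (F' := Fmax N) i (by ext; simp [truthProfile, Fmax]),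
        V_congr g c (s := Function.update _ i s') (F' := Fmin N) i (by ext; simp [hs, Fmin]),
        Function.update_self, V_Fmin]
      rw [V_Fmin] at hi
      have h4 : truthProfile N i = sT := rfl
      rw [h4]
      linarith [hnonneg i s']

end
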